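/- Equality case of the Jensen-type inequality for the log-concave profile likelihood functional (Theorem A.6, equality part). Let X and Y be independent real random variables with respective distributions P and Q, where Q ∈ 𝒬*, P(X ≥ 0) = 1 and E log X = m < ∞. Let R denote the distribution of XY. Then L(R) = L(Q) − m holds if and only if X = e^m with probability one (interpreting e^{−∞} = 0 when m = −∞). -/

import Mathlib

open MeasureTheory ProbabilityTheory Filter Topology
open scoped ENNReal NNReal

noncomputable section

/-- The exponential map `EReal → ℝ≥0∞` (sends `⊥` to `0` and `⊤` to `∞`). -/
def expEReal (x : EReal) : ℝ≥0∞ :=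
  if x = ⊥ then 0 else if x = ⊤ then ⊤ else ENNReal.ofReal (Real.exp x.toReal)

/-- Real-valued exponential of an extended real (sends `⊥` to `0`). -/
def expE (x : EReal) : ℝ := (expEReal x).toReal

/-- Extended-real logarithm of a real number (`⊥` for nonpositive input). -/
def elog (r : ℝ) : EReal := if r ≤ 0 then (⊥ : EReal) else ((Real.log r : ℝ) : EReal)

/-- Concavity for `EReal`-valued functions on `ℝ`. -/
def ErealConcaveOn (φ : ℝ → EReal) : Prop :=
  ∀ x y t : ℝ, 0 ≤ t → t ≤ 1 →
    (t : EReal) * φ x + ((1 - t : ℝ) : EReal) * φ y ≤ φ (t * x + (1 - t) * y)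

/-- The class `Φ` of concave, upper semicontinuous, coercive functions `ℝ → [-∞, ∞)`. -/
def MemPhi (φ : ℝ → EReal) : Prop :=
  (∀ x, φ x ≠ ⊤) ∧ ErealConcaveOn φ ∧ UpperSemicontinuous φ ∧
    Tendsto φ (cocompact ℝ) (𝓝 ⊥)

/-- Positive part of an extended real, valued in `ℝ≥0∞`. -/
def erealPosPart (x : EReal) : ℝ≥0∞ := if x = ⊤ then ⊤ else ENNReal.ofReal x.toReal

/-- Integral of an `EReal`-valued function against a measure on `ℝ`. -/
def integralEReal (Q : Measure ℝ) (φ : ℝ → EReal) : EReal :=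
  ((∫⁻ x, erealPosPart (φ x) ∂Q : ℝ≥0∞) : EReal)
    - ((∫⁻ x, erealPosPart (-(φ x)) ∂Q : ℝ≥0∞) : EReal)

/-- `𝒬*`: probability distributions on `ℝ` with finite first moment and nonzero variance. -/
def MemQstar (Q : Measure ℝ) : Prop :=
  IsProbabilityMeasure Q ∧ Integrable (fun x : ℝ => x) Q ∧ ¬ ∃ c : ℝ, Q = Measure.dirac c

open Classical in
/-- The profile log-likelihood functional `L`. -/
def Lfunc (Q : Measure ℝ) : EReal :=
  if ¬ Integrable (fun x : ℝ => x) Q then ⊥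
  else if ∃ c : ℝ, Q = Measure.dirac c then ⊤
  else sSup {r : EReal | ∃ φ, MemPhi φ ∧
    r = integralEReal Q φ - ((∫⁻ x, expEReal (φ x) : ℝ≥0∞) : EReal) + 1}

/-- `ψ` is the log-concave projection of `Q`: a maximizer over `Φ` of
`φ ↦ ∫ φ dQ − ∫ e^φ dx + 1`. -/
def IsLogConcaveProj (Q : Measure ℝ) (ψ : ℝ → EReal) : Prop :=
  MemPhi ψ ∧ ∀ φ, MemPhi φ →
    integralEReal Q φ - ((∫⁻ x, expEReal (φ x) : ℝ≥0∞) : EReal) + 1 ≤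
      integralEReal Q ψ - ((∫⁻ x, expEReal (ψ x) : ℝ≥0∞) : EReal) + 1

/-- A nonnegative function on `ℝ` is log-concave. -/
def IsLogConcaveFn (f : ℝ → ℝ) : Prop :=
  (∀ x, 0 ≤ f x) ∧ ∀ x y t : ℝ, 0 ≤ t → t ≤ 1 →
    f x ^ t * f y ^ (1 - t) ≤ f (t * x + (1 - t) * y)

/-- A log-concave probability density on `ℝ`. -/
def IsLogConcaveDensity (f : ℝ → ℝ) : Prop :=
  IsLogConcaveFn f ∧ (∫ x, f x) = 1

/-- `f` is the best log-concave approximation `f₀*` of `Q`. -/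
def IsBestLogConcaveApprox (Q : Measure ℝ) (f : ℝ → ℝ) : Prop :=
  IsLogConcaveDensity f ∧ ∀ g, IsLogConcaveDensity g →
    integralEReal Q (fun x => elog (g x)) ≤ integralEReal Q (fun x => elog (f x))

/-- The first Mallows (Wasserstein-1) distance between two measures on `ℝ`. -/
def mallows1 (μ ν : Measure ℝ) : ℝ≥0∞ :=
  ⨅ (γ : Measure (ℝ × ℝ)) (_ : γ.map Prod.fst = μ) (_ : γ.map Prod.snd = ν),
    ∫⁻ p, ENNReal.ofReal |p.1 - p.2| ∂γ

/-- A family of random variables is i.i.d. with common distribution `Q`. -/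
def IsIID {Ω : Type*} [MeasurableSpace Ω] (μ : Measure Ω) {ι : Type*}
    (ε : ι → Ω → ℝ) (Q : Measure ℝ) : Prop :=
  iIndepFun ε μ ∧ ∀ i, μ.map (ε i) = Q

/-- ARMA polynomial `A_θ(z) = 1 - ∑ aᵢ zⁱ`. -/
def armaA {p : ℕ} (a : Fin p → ℝ) (z : ℂ) : ℂ := 1 - ∑ i : Fin p, (a i : ℂ) * z ^ ((i : ℕ) + 1)

/-- ARMA polynomial `B_θ(z) = 1 + ∑ bᵢ zⁱ`. -/
def armaB {q : ℕ} (b : Fin q → ℝ) (z : ℂ) : ℂ := 1 + ∑ i : Fin q, (b i : ℂ) * z ^ ((i : ℕ) + 1)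

/-- GARCH polynomial `𝒜_θ(z) = ∑ αᵢ zⁱ`. -/
def garchA {r : ℕ} (α : Fin r → ℝ) (z : ℂ) : ℂ := ∑ i : Fin r, (α i : ℂ) * z ^ ((i : ℕ) + 1)

/-- GARCH polynomial `ℬ_θ(z) = 1 - ∑ βᵢ zⁱ`. -/
def garchB {s : ℕ} (β : Fin s → ℝ) (z : ℂ) : ℂ := 1 - ∑ i : Fin s, (β i : ℂ) * z ^ ((i : ℕ) + 1)

/-- The last coefficient of a coefficient vector (`0` if the vector is empty). -/
def lastC {k : ℕ} (v : Fin k → ℝ) : ℝ := if h : 0 < k then v ⟨k - 1, Nat.sub_lt h one_pos⟩ else 0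

/-- The ARMA log-concave objective
`Λ_n(φ, θ) = (1/n) ∑ φ(ε̃ₜ(θ)) − ∫ e^φ + 1`, as a function of `φ` and the residuals. -/
def armaLam (n : ℕ) (φ : ℝ → EReal) (res : ℤ → ℝ) : EReal :=
  ((1 / (n : ℝ) : ℝ) : EReal) * ∑ t ∈ Finset.Icc 1 n, φ (res (t : ℤ))
    - ((∫⁻ x, expEReal (φ x) : ℝ≥0∞) : EReal) + 1

/-- The ARMA-GARCH log-concave objective
`Λ_n(φ, θ) = (1/n) ∑ φ(η̃ₜ/σ̃ₜ) − (1/2n) ∑ log σ̃ₜ² − ∫ e^φ + 1`. -/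
def garchLam (n : ℕ) (φ : ℝ → EReal) (eta sig2 : ℤ → ℝ) : EReal :=
  ((1 / (n : ℝ) : ℝ) : EReal) * ∑ t ∈ Finset.Icc 1 n, φ (eta (t : ℤ) / Real.sqrt (sig2 (t : ℤ)))
    - (((1 / (2 * (n : ℝ))) * ∑ t ∈ Finset.Icc 1 n, Real.log (sig2 (t : ℤ)) : ℝ) : EReal)
    - ((∫⁻ x, expEReal (φ x) : ℝ≥0∞) : EReal) + 1

end

noncomputable section

lemma expE_bot : expE ⊥ = 0 := by simp [expE, expEReal]
lemma expE_coe (c : ℝ) : expE (c : EReal) = Real.exp c := by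
  simp [expE, expEReal, ENNReal.toReal_ofReal (Real.exp_pos c).le]
lemma expE_nonneg (x : EReal) : 0 ≤ expE x := ENNReal.toReal_nonneg
lemma le_expE {c : ℝ} {x : EReal} (hx : x ≠ ⊤) (h : (c : EReal) ≤ x) : Real.exp c ≤ expE x := by
  induction x with
  | bot => simp at h
  | top => exact absurd rfl hx
  | coe r => rw [expE_coe]; exact Real.exp_le_exp.2 (by exact_mod_cast h)
lemma expE_le {c : ℝ} {x : EReal} (h : x ≤ (c : EReal)) : expE x ≤ Real.exp c := by
  induction x with
  | bot => rw [expE_bot]; exact (Real.exp_pos c).le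
  | top => simp at h
  | coe r => rw [expE_coe]; exact Real.exp_le_exp.2 (by exact_mod_cast h)
lemma expEReal_eq {x : EReal} (hx : x ≠ ⊤) : expEReal x = ENNReal.ofReal (expE x) := by
  induction x with
  | bot => simp [expE_bot, expEReal]
  | top => exact absurd rfl hx
  | coe r => rw [expE_coe]; simp [expEReal]
lemma measurable_expEReal : Measurable expEReal := by
  unfold expEReal
  refine Measurable.ite (measurableSet_singleton _) measurable_const
    (Measurable.ite (measurableSet_singleton _) measurable_const ?_)
  exact (Real.measurable_exp.comp measurable_ereal_toReal).ennreal_ofReal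
lemma measurable_expE : Measurable expE := measurable_expEReal.ennreal_toReal

lemma conc_of_memPhi {φ : ℝ → EReal} (h : MemPhi φ) {x y c d t : ℝ} (hc : (c : EReal) ≤ φ x)
    (hd : (d : EReal) ≤ φ y) (h0 : 0 ≤ t) (h1 : t ≤ 1) :
    ((t * c + (1 - t) * d : ℝ) : EReal) ≤ φ (t * x + (1 - t) * y) := by
  refine le_trans ?_ (h.2.1 x y t h0 h1)
  rw [EReal.coe_add, EReal.coe_mul, EReal.coe_mul]
  refine add_le_add (mul_le_mul_of_nonneg_left hc ?_) (mul_le_mul_of_nonneg_left hd ?_)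
  · exact_mod_cast h0
  · exact_mod_cast sub_nonneg.2 h1

lemma concave_of {φ : ℝ → EReal} (htop : ∀ x, φ x ≠ ⊤)
    (H : ∀ x y c d t : ℝ, φ x = c → φ y = d → 0 ≤ t → t ≤ 1 →
      ((t * c + (1 - t) * d : ℝ) : EReal) ≤ φ (t * x + (1 - t) * y)) : ErealConcaveOn φ := by
  intro x y t h0 h1
  rcases eq_or_lt_of_le h0 with rfl | h0'
  · simp
  rcases eq_or_lt_of_le h1 with rfl | h1'
  · simp
  have h1s : 0 < 1 - t := sub_pos.2 h1'
  by_cases hx : φ x = ⊥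
  · rw [hx, EReal.coe_mul_bot_of_pos h0']; simp
  by_cases hy : φ y = ⊥
  · rw [hy, EReal.coe_mul_bot_of_pos h1s]; simp
  have ex := EReal.coe_toReal (htop x) hx
  have ey := EReal.coe_toReal (htop y) hy
  have := H x y _ _ t ex.symm ey.symm h0 h1
  rw [EReal.coe_add, EReal.coe_mul, EReal.coe_mul, ex, ey] at this
  exact this

/-- rescaling -/
def scl (φ : ℝ → EReal) (s c : ℝ) : ℝ → EReal := fun y => φ (s * y) + (c : EReal)

lemma memPhi_scl {φ : ℝ → EReal} (h : MemPhi φ) {s : ℝ} (hs : 0 < s) (c : ℝ) :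
    MemPhi (scl φ s c) := by
  have htop : ∀ x, scl φ s c x ≠ ⊤ := fun x => EReal.add_ne_top (h.1 _) (EReal.coe_ne_top _)
  refine ⟨htop, concave_of htop ?_, ?_, ?_⟩
  · intro x y a b t hx hy h0 h1
    have key : ∀ z a, scl φ s c z = (a : ℝ) → ((a - c : ℝ) : EReal) ≤ φ (s * z) := by
      intro z a hz
      unfold scl at hz
      generalize φ (s * z) = w at hz
      induction w with
      | bot => simp at hz
      | top => simp
      | coe r => 
        have : r + c = a := by exact_mod_cast hz
        exact_mod_cast (by linarith : a - c ≤ r)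
    have := conc_of_memPhi h (key x a hx) (key y b hy) h0 h1
    have e : t * (s * x) + (1 - t) * (s * y) = s * (t * x + (1 - t) * y) := by ring
    rw [e] at this
    have h2 := add_le_add_left this (c : EReal)
    refine le_trans (le_of_eq ?_) h2
    rw [← EReal.coe_add]; congr 1; ring
  · have h1 : UpperSemicontinuous (fun y => φ (s * y)) :=
      h.2.2.1.comp (continuous_const.mul continuous_id)
    refine h1.add' (g := fun _ => (c : EReal)) upperSemicontinuous_const ?_
    intro x
    exact EReal.continuousAt_add (Or.inr (EReal.coe_ne_bot _)) (Or.inr (EReal.coe_ne_top _))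
  · have h1 : Tendsto (fun y : ℝ => s * y) (cocompact ℝ) (cocompact ℝ) :=
      (Homeomorph.mulLeft₀ s hs.ne').isClosedEmbedding.tendsto_cocompact
    have h2 := h.2.2.2.comp h1
    have h3 := (EReal.continuousAt_add (p := (⊥, (c : EReal))) (Or.inl (by simp))
      (Or.inr (by simp))).tendsto.comp (h2.prodMk_nhds (tendsto_const_nhds (x := (c : EReal))))
    rw [EReal.bot_add] at h3
    exact h3

/-- half-sum -/
def hsum (f g : ℝ → EReal) : ℝ → EReal := fun y => ((1 / 2 : ℝ) : EReal) * (f y + g y)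

lemma half_mono : Monotone (fun x : EReal => ((1 / 2 : ℝ) : EReal) * x) := by
  intro a b hab
  refine mul_le_mul_of_nonneg_left hab ?_
  exact_mod_cast (by norm_num : (0 : ℝ) ≤ 1 / 2)

lemma half_cont : Continuous (fun x : EReal => ((1 / 2 : ℝ) : EReal) * x) := by
  rw [continuous_iff_continuousAt]
  intro x
  exact EReal.Tendsto.const_mul tendsto_id (Or.inl (EReal.coe_ne_bot _)) (Or.inl (EReal.coe_ne_top _))

lemma hsum_cases (f g : ℝ → EReal) (hf : ∀ x, f x ≠ ⊤) (hg : ∀ x, g x ≠ ⊤) (y : ℝ) :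
    ((f y = ⊥ ∨ g y = ⊥) ∧ hsum f g y = ⊥) ∨
    ∃ a b : ℝ, f y = a ∧ g y = b ∧ hsum f g y = ((1 / 2 * (a + b) : ℝ) : EReal) := by
  by_cases h1 : f y = ⊥
  · left; refine ⟨Or.inl h1, ?_⟩
    unfold hsum; rw [h1, EReal.bot_add, EReal.coe_mul_bot_of_pos (by norm_num)]
  by_cases h2 : g y = ⊥
  · left; refine ⟨Or.inr h2, ?_⟩
    unfold hsum; rw [h2, EReal.add_bot, EReal.coe_mul_bot_of_pos (by norm_num)]
  right
  refine ⟨_, _, (EReal.coe_toReal (hf y) h1).symm, (EReal.coe_toReal (hg y) h2).symm, ?_⟩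
  unfold hsum
  rw [EReal.coe_mul, EReal.coe_add, EReal.coe_toReal (hf y) h1, EReal.coe_toReal (hg y) h2]

lemma memPhi_hsum {f g : ℝ → EReal} (hf : MemPhi f) (hg : MemPhi g) : MemPhi (hsum f g) := by
  have htop : ∀ x, hsum f g x ≠ ⊤ := by
    intro x
    rcases hsum_cases f g hf.1 hg.1 x with ⟨_, h⟩ | ⟨a, b, _, _, h⟩ <;> rw [h] <;> simp
    exact_mod_cast EReal.coe_ne_top _
  refine ⟨htop, concave_of htop ?_, ?_, ?_⟩
  · intro x y a b t hx hy h0 h1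
    rcases hsum_cases f g hf.1 hg.1 x with ⟨_, h⟩ | ⟨a1, a2, hx1, hx2, h⟩
    · rw [h] at hx; simp at hx
    rw [h] at hx
    rcases hsum_cases f g hf.1 hg.1 y with ⟨_, h⟩ | ⟨b1, b2, hy1, hy2, h⟩
    · rw [h] at hy; simp at hy
    rw [h] at hy
    have ea : 1 / 2 * (a1 + a2) = a := by exact_mod_cast hx
    have eb : 1 / 2 * (b1 + b2) = b := by exact_mod_cast hy
    have h3 := add_le_add (conc_of_memPhi hf hx1.ge hy1.ge h0 h1)
      (conc_of_memPhi hg hx2.ge hy2.ge h0 h1)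
    have h4 := half_mono h3
    refine le_trans (le_of_eq ?_) h4
    simp only
    rw [← EReal.coe_add, ← EReal.coe_mul]; congr 1; rw [← ea, ← eb]; ring
  · have h1 : UpperSemicontinuous (fun y => f y + g y) := by
      refine hf.2.2.1.add' hg.2.2.1 ?_
      intro x
      exact EReal.continuousAt_add (Or.inl (hf.1 x)) (Or.inr (hg.1 x))
    exact half_cont.comp_upperSemicontinuous h1 half_mono
  · have h3 := (EReal.continuousAt_add (p := (⊥, ⊥)) (Or.inl (by simp))
      (Or.inr (by simp))).tendsto.comp (hf.2.2.2.prodMk_nhds hg.2.2.2)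
    have h4 := half_cont.continuousAt.tendsto.comp h3
    have e : ((1 / 2 : ℝ) : EReal) * ((⊥ : EReal) + ⊥) = ⊥ := by
      rw [EReal.bot_add, EReal.coe_mul_bot_of_pos (by norm_num)]
    simp only at h4
    rw [e] at h4
    exact h4

lemma expE_scl {φ : ℝ → EReal} {s : ℝ} (c : ℝ) (h : ∀ x, φ x ≠ ⊤) (y : ℝ) :
    expE (scl φ s c y) = Real.exp c * expE (φ (s * y)) := by
  unfold scl
  have := h (s * y)
  generalize φ (s * y) = w at this
  induction w with
  | bot => simp [expE_bot]
  | top => exact absurd rfl this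
  | coe r => rw [← EReal.coe_add, expE_coe, expE_coe, Real.exp_add, mul_comm]

lemma expE_hsum {f g : ℝ → EReal} (hf : ∀ x, f x ≠ ⊤) (hg : ∀ x, g x ≠ ⊤) (y : ℝ) :
    expE (hsum f g y) = √(expE (f y) * expE (g y)) := by
  rcases hsum_cases f g hf hg y with ⟨h1 | h1, h⟩ | ⟨a, b, h1, h2, h⟩
  · rw [h, h1, expE_bot]; simp
  · rw [h, h1, expE_bot]; simp
  · rw [h, h1, h2, expE_coe, expE_coe, expE_coe, ← Real.exp_add, Real.sqrt_eq_rpow, ← Real.exp_mul]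
    congr 1; ring

end

noncomputable section

lemma exists_max {φ : ℝ → EReal} (h : MemPhi φ) (hne : ∃ x, φ x ≠ ⊥) :
    ∃ x0 M : ℝ, φ x0 = M ∧ ∀ x, φ x ≤ M := by
  obtain ⟨z, hz⟩ := hne
  have hz' : ⊥ < φ z := bot_lt_iff_ne_bot.2 hz
  have hev : ∀ᶠ x in cocompact ℝ, φ x < φ z := h.2.2.2.eventually (gt_mem_nhds hz')
  obtain ⟨K, hK, hKs⟩ := mem_cocompact.1 hev
  have hK' : IsCompact (insert z K) := hK.insert z
  obtain ⟨x0, -, hmax⟩ := UpperSemicontinuousOn.exists_isMaxOn ⟨z, Set.mem_insert z K⟩ hK'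
    (h.2.2.1.upperSemicontinuousOn _)
  have hzx : φ z ≤ φ x0 := hmax (Set.mem_insert z K)
  have hall : ∀ x, φ x ≤ φ x0 := by
    intro x
    by_cases hx : x ∈ K
    · exact hmax (Set.mem_insert_of_mem z hx)
    · exact (le_of_lt (hKs hx)).trans hzx
  have hb : φ x0 ≠ ⊥ := (lt_of_lt_of_le hz' hzx).ne'
  refine ⟨x0, (φ x0).toReal, (EReal.coe_toReal (h.1 _) hb).symm, fun x => ?_⟩
  rw [EReal.coe_toReal (h.1 _) hb]; exact hall x

lemma decay {φ : ℝ → EReal} (h : MemPhi φ) {x0 M τ : ℝ} (hx0 : φ x0 = M) (hM : ∀ x, φ x ≤ M)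
    (hτ : 0 < τ) (hp : φ (x0 + τ) < ((M - 1 : ℝ) : EReal)) (hn : φ (x0 - τ) < ((M - 1 : ℝ) : EReal))
    (x : ℝ) : φ x ≤ ((M + 1 - |x - x0| / τ : ℝ) : EReal) := by
  by_cases hc : |x - x0| < τ
  · refine (hM x).trans ?_
    have : |x - x0| / τ ≤ 1 := (div_le_one hτ).2 hc.le
    exact_mod_cast (by linarith : M ≤ M + 1 - |x - x0| / τ)
  push Not at hc
  have hpos : 0 < |x - x0| := lt_of_lt_of_le hτ hc
  suffices φ x ≤ ((M - |x - x0| / τ : ℝ) : EReal) by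
    refine this.trans ?_
    exact_mod_cast (by linarith : M - |x - x0| / τ ≤ M + 1 - |x - x0| / τ)
  by_contra hcon
  push Not at hcon
  have h1 : τ / |x - x0| ≤ 1 := (div_le_one hpos).2 hc
  have h0 : 0 ≤ τ / |x - x0| := by positivity
  have := conc_of_memPhi h hcon.le hx0.ge h0 h1
  have e : τ / |x - x0| * (M - |x - x0| / τ) + (1 - τ / |x - x0|) * M = M - 1 := by
    field_simp; ring
  rw [e] at this
  rcases le_total x0 x with hx | hx
  · have e2 : τ / |x - x0| * x + (1 - τ / |x - x0|) * x0 = x0 + τ := by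
      rw [abs_of_nonneg (sub_nonneg.2 hx)] at *
      field_simp; ring
    rw [e2] at this
    exact absurd hp (not_lt.2 this)
  · have e2 : τ / |x - x0| * x + (1 - τ / |x - x0|) * x0 = x0 - τ := by
      rw [abs_of_nonpos (sub_nonpos.2 hx)] at *
      rw [neg_sub] at *
      have h3 : x0 - x ≠ 0 := by linarith
      field_simp; ring
    rw [e2] at this
    exact absurd hn (not_lt.2 this)

lemma integrable_lap : Integrable (fun x : ℝ => Real.exp (-|x|)) := by
  refine not_imp_comm.1 integral_undef ?_
  rw [integral_comp_abs (f := fun y => Real.exp (-y)), integral_exp_neg_Ioi]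
  simp

lemma integrable_lap' (x0 τ : ℝ) (hτ : 0 < τ) (M : ℝ) :
    Integrable (fun x : ℝ => Real.exp (M + 1 - |x - x0| / τ)) ∧
    ∫ x : ℝ, Real.exp (M + 1 - |x - x0| / τ) = Real.exp (M + 1) * (2 * τ) := by
  have e : (fun x : ℝ => Real.exp (M + 1 - |x - x0| / τ)) =
      fun x => Real.exp (M + 1) * (fun y => Real.exp (-|τ⁻¹ * y|)) (x - x0) := by
    ext x
    simp only
    rw [abs_mul, abs_of_pos (inv_pos.2 hτ), ← Real.exp_add]; congr 1; field_simp; ring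
  have i1 : Integrable (fun y : ℝ => Real.exp (-|τ⁻¹ * y|)) :=
    integrable_lap.comp_mul_left' (inv_pos.2 hτ).ne'
  rw [e]
  refine ⟨(i1.comp_sub_right x0).const_mul _, ?_⟩
  rw [integral_const_mul, integral_sub_right_eq_self (fun y : ℝ => Real.exp (-|τ⁻¹ * y|)),
    Measure.integral_comp_mul_left (fun y : ℝ => Real.exp (-|y|)),
    integral_comp_abs (f := fun y => Real.exp (-y)), integral_exp_neg_Ioi]
  simp [abs_of_pos hτ]; ring

lemma bound_exp {φ : ℝ → EReal} (h : MemPhi φ) {x0 M τ : ℝ} (hx0 : φ x0 = M) (hM : ∀ x, φ x ≤ M)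
    (hτ : 0 < τ) (hp : φ (x0 + τ) < ((M - 1 : ℝ) : EReal)) (hn : φ (x0 - τ) < ((M - 1 : ℝ) : EReal)) :
    Integrable (fun x => expE (φ x)) ∧ ∫ x, expE (φ x) ≤ Real.exp (M + 1) * (2 * τ) := by
  obtain ⟨i1, e1⟩ := integrable_lap' x0 τ hτ M
  have hb : ∀ x, expE (φ x) ≤ Real.exp (M + 1 - |x - x0| / τ) :=
    fun x => expE_le (decay h hx0 hM hτ hp hn x)
  have i2 : Integrable (fun x => expE (φ x)) := by
    refine i1.mono' (measurable_expE.comp h.2.2.1.measurable).aestronglyMeasurable ?_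
    filter_upwards with x
    rw [Real.norm_of_nonneg (expE_nonneg _)]; exact hb x
  refine ⟨i2, ?_⟩
  rw [← e1]
  exact integral_mono i2 i1 hb

lemma integrable_expE {φ : ℝ → EReal} (h : MemPhi φ) : Integrable (fun x => expE (φ x)) := by
  by_cases hne : ∃ x, φ x ≠ ⊥
  · obtain ⟨x0, M, hx0, hM⟩ := exists_max h hne
    have hev : ∀ᶠ x in cocompact ℝ, φ x < ((M - 1 : ℝ) : EReal) :=
      h.2.2.2.eventually (gt_mem_nhds (EReal.bot_lt_coe _))
    rw [cocompact_eq_atBot_atTop, eventually_sup] at hev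
    have h1 : Tendsto (fun τ : ℝ => x0 + τ) atTop atTop := tendsto_atTop_add_const_left _ _ tendsto_id
    have h2 : Tendsto (fun τ : ℝ => x0 - τ) atTop atBot :=
      tendsto_atBot_add_const_left _ x0 tendsto_neg_atTop_atBot
    obtain ⟨τ, ⟨ha, hb⟩, hτ⟩ := ((h1.eventually hev.2).and (h2.eventually hev.1)).and
      (eventually_gt_atTop 0) |>.exists
    exact (bound_exp h hx0 hM hτ ha hb).1
  · push Not at hne
    simp [hne, expE_bot]

lemma lintegral_expEReal {φ : ℝ → EReal} (h : MemPhi φ) :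
    ∫⁻ x, expEReal (φ x) = ENNReal.ofReal (∫ x, expE (φ x)) := by
  rw [ofReal_integral_eq_lintegral_ofReal (integrable_expE h) (ae_of_all _ fun x => expE_nonneg _)]
  exact lintegral_congr fun x => expEReal_eq (h.1 x)

lemma seg_ge {φ : ℝ → EReal} (h : MemPhi φ) {l r c : ℝ} (hl : (c : EReal) ≤ φ l)
    (hr : (c : EReal) ≤ φ r) {x : ℝ} (hx1 : l ≤ x) (hx2 : x ≤ r) : (c : EReal) ≤ φ x := by
  rcases eq_or_lt_of_le (hx1.trans hx2) with e | hlt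
  · have : x = l := by linarith
    rwa [this]
  have hd : 0 < r - l := by linarith
  have := conc_of_memPhi h hl hr (t := (r - x) / (r - l)) (div_nonneg (by linarith) hd.le)
    ((div_le_one hd).2 (by linarith))
  have e1 : (r - x) / (r - l) * c + (1 - (r - x) / (r - l)) * c = c := by ring
  have e2 : (r - x) / (r - l) * l + (1 - (r - x) / (r - l)) * r = x := by
    field_simp; ring
  rwa [e1, e2] at this

lemma segment_lem {φ : ℝ → EReal} (h : MemPhi φ) {x0 M : ℝ} (hx0 : φ x0 = M) (hM : ∀ x, φ x ≤ M)
    (hW : 0 < ∫ x, expE (φ x)) :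
    ∃ l r : ℝ, r - l = (∫ x, expE (φ x)) / (4 * Real.exp (M + 1)) ∧
      ∀ x, l ≤ x → x ≤ r → ((M - 1 : ℝ) : EReal) ≤ φ x := by
  set W := ∫ x, expE (φ x) with hWd
  set τ := W / (4 * Real.exp (M + 1)) with hτd
  have hτ : 0 < τ := by positivity
  have hM1 : ((M - 1 : ℝ) : EReal) ≤ φ x0 := by
    rw [hx0]; exact_mod_cast (by linarith : M - 1 ≤ M)
  by_cases hp : φ (x0 + τ) < ((M - 1 : ℝ) : EReal)
  · by_cases hn : φ (x0 - τ) < ((M - 1 : ℝ) : EReal)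
    · have := (bound_exp h hx0 hM hτ hp hn).2
      have e : Real.exp (M + 1) * (2 * τ) = W / 2 := by
        rw [hτd]; field_simp; ring
      rw [e] at this
      linarith
    · push Not at hn
      exact ⟨x0 - τ, x0, by ring, fun x h1 h2 => seg_ge h hn hM1 h1 h2⟩
  · push Not at hp
    exact ⟨x0, x0 + τ, by ring, fun x h1 h2 => seg_ge h hM1 hp h1 h2⟩

lemma annulus {s0 s l r : ℝ} (hs0 : 1 < s0) (hs : s0 ≤ s) (hlr : l < r) :
    ∃ a l' r' : ℝ, 0 < a ∧ l ≤ l' ∧ r' ≤ r ∧ r' - l' = (r - l) * ((1 - 1 / s0) / 2) ∧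
      ∀ x, l' < x → x < r' → a < |x| ∧ |x| ≤ s * a := by
  have hs1 : 1 < s := by linarith
  have hs' : 0 < s := by linarith
  have hi : 1 / s ≤ 1 / s0 := one_div_le_one_div_of_le (by linarith) hs
  have hi1 : 1 / s0 < 1 := (div_lt_one (by linarith)).2 hs0
  have hi0 : 0 < 1 / s := by positivity
  by_cases hc : -l ≤ r
  · have hr : 0 < r := by linarith
    have hd : (r - l) * ((1 - 1 / s0) / 2) ≤ r * (1 - 1 / s) := by nlinarith
    refine ⟨r / s, r - (r - l) * ((1 - 1 / s0) / 2), r, by positivity, by nlinarith, le_rfl,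
      by ring, fun x h1 h2 => ?_⟩
    have e : r / s = r - r * (1 - 1 / s) := by ring
    have e2 : s * (r / s) = r := by field_simp
    have hx : 0 < r / s := by positivity
    rw [abs_of_pos (by linarith)]
    constructor <;> linarith
  · push Not at hc
    have hr : 0 < -l := by linarith
    have hd : (r - l) * ((1 - 1 / s0) / 2) ≤ -l * (1 - 1 / s) := by nlinarith
    refine ⟨-l / s, l, l + (r - l) * ((1 - 1 / s0) / 2), by positivity, le_rfl, by nlinarith,
      by ring, fun x h1 h2 => ?_⟩
    have e : -l / s = -l - -l * (1 - 1 / s) := by ring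
    have e2 : s * (-l / s) = -l := by field_simp
    have hx : 0 < -l / s := by positivity
    rw [abs_of_neg (by linarith)]
    constructor <;> linarith

lemma sqrt_bound {F G ε : ℝ} (hF : 0 ≤ F) (hG : 0 ≤ G) :
    √(F * G) ≤ 1 / 2 * (F + G) * (1 + ε ^ 2 / 2) - ε / 2 * (G - F) := by
  rw [Real.sqrt_mul hF]
  have h1 := Real.sq_sqrt hF
  have h2 := Real.sq_sqrt hG
  set u := √F
  set v := √G
  rw [← h1, ← h2]
  nlinarith [sq_nonneg ((v - u) - ε / 2 * (u + v)), mul_nonneg (sq_nonneg ε) (sq_nonneg (u - v))]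

lemma integral_scl {φ : ℝ → EReal} (h : MemPhi φ) {s : ℝ} (hs : 0 < s) :
    ∫ x, expE (scl φ s (Real.log s) x) = ∫ x, expE (φ x) := by
  simp_rw [expE_scl (Real.log s) h.1, Real.exp_log hs]
  rw [integral_const_mul, Measure.integral_comp_mul_left (fun x => expE (φ x)),
    abs_of_pos (inv_pos.2 hs), smul_eq_mul, mul_inv_cancel_left₀ hs.ne']

/-- the constant -/
def kap (s0 : ℝ) : ℝ := (1 / (4 * Real.exp 2)) * ((1 - 1 / s0) / 2)

lemma kap_pos {s0 : ℝ} (hs0 : 1 < s0) : 0 < kap s0 := by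
  have hi1 : 1 / s0 < 1 := (div_lt_one (by linarith)).2 hs0
  unfold kap
  have := Real.exp_pos 2
  have : 0 < 1 - 1 / s0 := by linarith
  positivity

lemma hell {φ : ℝ → EReal} (h : MemPhi φ) {s0 s : ℝ} (hs0 : 1 < s0) (hs : s0 ≤ s)
    (hW : 0 < ∫ x, expE (φ x)) :
    ∫ x, expE (hsum φ (scl φ s (Real.log s)) x) ≤
      (∫ x, expE (φ x)) * (1 - (kap s0) ^ 2 / 8) := by
  have hs' : 0 < s := by linarith
  have hne : ∃ x, φ x ≠ ⊥ := by
    by_contra hcon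
    push Not at hcon
    simp [hcon, expE_bot] at hW
  obtain ⟨x0, M, hx0, hM⟩ := exists_max h hne
  obtain ⟨l, r, hlr, hseg⟩ := segment_lem h hx0 hM hW
  have hg := memPhi_scl h hs' (Real.log s)
  have iF := integrable_expE h
  have iG := integrable_expE hg
  have iH := integrable_expE (memPhi_hsum h hg)
  have eG := integral_scl h hs'
  set W := ∫ x, expE (φ x) with hWd
  have hlr' : l < r := by
    have : 0 < W / (4 * Real.exp (M + 1)) := by positivity
    linarith
  obtain ⟨a, l', r', ha, hl', hr', hlr2, hann⟩ := annulus hs0 hs hlr'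
  set κ := kap s0 with hκ
  set E := Set.Icc (-a) a with hE
  set E' := Set.Icc (-(s * a)) (s * a) with hE'
  have hEE : E ⊆ E' := by
    have : a ≤ s * a := by nlinarith
    exact Set.Icc_subset_Icc (by linarith) this
  -- integral of G over E
  have eGE : ∫ x in E, expE (scl φ s (Real.log s) x) = ∫ x in E', expE (φ x) := by
    rw [← integral_indicator measurableSet_Icc, ← integral_indicator measurableSet_Icc]
    have e : (E.indicator fun x => expE (scl φ s (Real.log s) x)) =
        fun x => s * (E'.indicator (fun x => expE (φ x))) (s * x) := by
      ext x
      by_cases hx : x ∈ E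
      · have hx' : s * x ∈ E' := ⟨by nlinarith [hx.1], by nlinarith [hx.2]⟩
        rw [Set.indicator_of_mem hx, Set.indicator_of_mem hx', expE_scl _ h.1, Real.exp_log hs']
      · have hx' : s * x ∉ E' := by
          intro hx'
          refine hx ⟨?_, ?_⟩
          · have := hx'.1
            by_contra hc
            push Not at hc
            nlinarith
          · have := hx'.2
            by_contra hc
            push Not at hc
            nlinarith
        rw [Set.indicator_of_notMem hx, Set.indicator_of_notMem hx', mul_zero]
    rw [e, integral_const_mul, Measure.integral_comp_mul_left, abs_of_pos (inv_pos.2 hs'),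
      smul_eq_mul, mul_inv_cancel_left₀ hs'.ne']
  have hdiff : κ * W ≤ (∫ x in E', expE (φ x)) - ∫ x in E, expE (φ x) := by
    rw [← setIntegral_sdiff measurableSet_Icc iF.integrableOn hEE]
    have hsub : Set.Ioo l' r' ⊆ E' \ E := by
      intro x hx
      obtain ⟨h1, h2⟩ := hann x hx.1 hx.2
      refine ⟨abs_le.1 h2, fun hh => ?_⟩
      exact absurd (abs_le.2 hh) (not_le.2 h1)
    have h1 : ∫ x in Set.Ioo l' r', Real.exp (M - 1) ≤ ∫ x in Set.Ioo l' r', expE (φ x) := by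
      refine setIntegral_mono_on (by simp) iF.integrableOn measurableSet_Ioo ?_
      intro x hx
      exact le_expE (h.1 x) (hseg x (hl'.trans hx.1.le) (hx.2.le.trans hr'))
    have h2 : ∫ x in Set.Ioo l' r', expE (φ x) ≤ ∫ x in E' \ E, expE (φ x) := by
      refine setIntegral_mono_set iF.integrableOn (ae_of_all _ fun x => expE_nonneg _) ?_
      exact hsub.eventuallyLE
    refine le_trans (le_of_eq ?_) (h1.trans h2)
    rw [setIntegral_const, smul_eq_mul, Measure.real, Real.volume_Ioo, hlr2,
      ENNReal.toReal_ofReal, hlr, hκ, kap]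
    · have e1 : Real.exp (M + 1) = Real.exp (M - 1) * Real.exp 2 := by
        rw [← Real.exp_add]; congr 1; ring
      rw [e1]
      have := Real.exp_pos (M - 1)
      have := Real.exp_pos 2
      field_simp
    · have := kap_pos hs0
      have hi1 : 1 / s0 < 1 := (div_lt_one (by linarith)).2 hs0
      have : 0 < r - l := by linarith
      have : 0 < 1 - 1 / s0 := by linarith
      positivity
  -- pointwise
  have hpt : ∀ x, expE (hsum φ (scl φ s (Real.log s)) x) ≤
      1 / 2 * (expE (φ x) + expE (scl φ s (Real.log s) x)) * (1 + (κ / 2) ^ 2 / 2) -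
        (κ / 2) / 2 * (E.indicator (fun x => expE (scl φ s (Real.log s) x)) x
          - E.indicator (fun x => expE (φ x)) x) := by
    intro x
    rw [expE_hsum h.1 hg.1]
    by_cases hx : x ∈ E
    · rw [Set.indicator_of_mem hx, Set.indicator_of_mem hx]
      exact sqrt_bound (expE_nonneg _) (expE_nonneg _)
    · rw [Set.indicator_of_notMem hx, Set.indicator_of_notMem hx]
      have := sqrt_bound (ε := 0) (expE_nonneg (φ x)) (expE_nonneg (scl φ s (Real.log s) x))
      have h3 : 0 ≤ (expE (φ x) + expE (scl φ s (Real.log s) x)) * (κ / 2) ^ 2 :=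
        mul_nonneg (add_nonneg (expE_nonneg _) (expE_nonneg _)) (sq_nonneg _)
      nlinarith
  have iFE : Integrable (E.indicator (fun x => expE (φ x))) := iF.indicator measurableSet_Icc
  have iGE : Integrable (E.indicator (fun x => expE (scl φ s (Real.log s) x))) :=
    iG.indicator measurableSet_Icc
  have i1 := ((iF.add iG).const_mul (1 / 2)).mul_const (1 + (κ / 2) ^ 2 / 2)
  have i2 := (iGE.sub iFE).const_mul ((κ / 2) / 2)
  have hfin := integral_mono iH (i1.sub i2) hpt
  refine hfin.trans ?_
  rw [integral_sub' i1 i2, integral_mul_const, integral_const_mul, integral_const_mul,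
    integral_add' iF iG, integral_sub' iGE iFE, integral_indicator measurableSet_Icc,
    integral_indicator measurableSet_Icc, eGE, eG]
  have hk := kap_pos hs0
  nlinarith [mul_le_mul_of_nonneg_left hdiff hk.le]

end

noncomputable section

lemma measurable_ePosPart : Measurable erealPosPart := by
  unfold erealPosPart
  refine Measurable.ite (measurableSet_singleton _) measurable_const ?_
  exact measurable_ereal_toReal.ennreal_ofReal

lemma posPart_coe (r : ℝ) : erealPosPart (r : EReal) = ENNReal.ofReal r := by
  simp [erealPosPart]

/-- finite and integrable -/
def GoodI (Q : Measure ℝ) (φ : ℝ → EReal) : Prop :=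
  (∀ᵐ x ∂Q, φ x ≠ ⊤ ∧ φ x ≠ ⊥) ∧ Integrable (fun x => (φ x).toReal) Q

lemma good_of_ne_top {Q : Measure ℝ} {φ : ℝ → EReal} (hm : Measurable φ)
    (hp : ∫⁻ x, erealPosPart (φ x) ∂Q ≠ ⊤) (hn : ∫⁻ x, erealPosPart (-(φ x)) ∂Q ≠ ⊤) :
    GoodI Q φ := by
  have h1 := ae_lt_top (measurable_ePosPart.comp hm) hp
  have h2 := ae_lt_top (measurable_ePosPart.comp hm.neg) hn
  have h3 : ∀ᵐ x ∂Q, φ x ≠ ⊤ ∧ φ x ≠ ⊥ := by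
    filter_upwards [h1, h2] with x hx1 hx2
    constructor
    · intro h; simp [h, erealPosPart] at hx1
    · intro h; simp [h, erealPosPart] at hx2
  refine ⟨h3, ?_⟩
  refine ⟨(measurable_ereal_toReal.comp hm).aestronglyMeasurable, ?_⟩
  have : ∫⁻ x, ‖(φ x).toReal‖ₑ ∂Q ≤
      ∫⁻ x, (erealPosPart (φ x) + erealPosPart (-(φ x))) ∂Q := by
    refine lintegral_mono_ae ?_
    filter_upwards [h3] with x hx
    have e := EReal.coe_toReal hx.1 hx.2
    generalize (φ x).toReal = r at e
    rw [← e, ← EReal.coe_neg, posPart_coe, posPart_coe]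
    rw [Real.enorm_eq_ofReal_abs]
    rcases le_total 0 r with h | h
    · rw [abs_of_nonneg h]; exact le_self_add
    · rw [abs_of_nonpos h]; exact le_add_self
  refine lt_of_le_of_lt this ?_
  rw [lintegral_add_left (f := fun x => erealPosPart (φ x)) (measurable_ePosPart.comp hm)]
  exact ENNReal.add_lt_top.2 ⟨hp.lt_top, hn.lt_top⟩

lemma integralEReal_of_good {Q : Measure ℝ} {φ : ℝ → EReal} (h : GoodI Q φ) :
    integralEReal Q φ = ((∫ x, (φ x).toReal ∂Q : ℝ) : EReal) := by
  have e1 : ∫⁻ x, erealPosPart (φ x) ∂Q = ∫⁻ x, ENNReal.ofReal ((φ x).toReal) ∂Q := by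
    refine lintegral_congr_ae ?_
    filter_upwards [h.1] with x hx
    conv_lhs => rw [← EReal.coe_toReal hx.1 hx.2, posPart_coe]
  have e2 : ∫⁻ x, erealPosPart (-(φ x)) ∂Q = ∫⁻ x, ENNReal.ofReal (-(φ x).toReal) ∂Q := by
    refine lintegral_congr_ae ?_
    filter_upwards [h.1] with x hx
    conv_lhs => rw [← EReal.coe_toReal hx.1 hx.2, ← EReal.coe_neg, posPart_coe]
  have f1 : ∫⁻ x, ENNReal.ofReal ((φ x).toReal) ∂Q ≠ ⊤ := h.2.lintegral_lt_top.ne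
  have f2 : ∫⁻ x, ENNReal.ofReal (-(φ x).toReal) ∂Q ≠ ⊤ := h.2.neg.lintegral_lt_top.ne
  unfold integralEReal
  rw [e1, e2, integral_eq_lintegral_pos_part_sub_lintegral_neg_part h.2, EReal.coe_sub,
    EReal.coe_ennreal_toReal f1, EReal.coe_ennreal_toReal f2]

lemma good_or_bot {Q : Measure ℝ} [IsProbabilityMeasure Q] {φ : ℝ → EReal} (h : MemPhi φ) :
    integralEReal Q φ = ⊥ ∨ GoodI Q φ := by
  have hm := h.2.2.1.measurable
  have hp : ∫⁻ x, erealPosPart (φ x) ∂Q ≠ ⊤ := by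
    by_cases hne : ∃ x, φ x ≠ ⊥
    · obtain ⟨x0, M, hx0, hM⟩ := exists_max h hne
      have : ∫⁻ x, erealPosPart (φ x) ∂Q ≤ ∫⁻ x, ENNReal.ofReal M ∂Q := by
        refine lintegral_mono fun x => ?_
        have h1 := hM x
        have h2 := h.1 x
        simp only
        generalize φ x = w at h1 h2
        induction w with
        | bot => simp [erealPosPart]
        | top => exact absurd rfl h2
        | coe r => rw [posPart_coe]; exact ENNReal.ofReal_le_ofReal (by exact_mod_cast h1)
      refine (lt_of_le_of_lt this ?_).ne
      simp
    · push Not at hne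
      simp [hne, erealPosPart]
  by_cases hn : ∫⁻ x, erealPosPart (-(φ x)) ∂Q = ⊤
  · left
    unfold integralEReal
    rw [hn, EReal.coe_ennreal_top, EReal.sub_top]
  · right; exact good_of_ne_top hm hp hn

/-- the objective -/
def Jf (Q : Measure ℝ) (φ : ℝ → EReal) : EReal :=
  integralEReal Q φ - ((∫⁻ x, expEReal (φ x) : ℝ≥0∞) : EReal) + 1

lemma Jf_good {Q : Measure ℝ} {φ : ℝ → EReal} (h : MemPhi φ) (hg : GoodI Q φ) :
    Jf Q φ = (((∫ x, (φ x).toReal ∂Q) - (∫ x, expE (φ x)) + 1 : ℝ) : EReal) := by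
  unfold Jf
  rw [integralEReal_of_good hg, lintegral_expEReal h, EReal.coe_ennreal_ofReal,
    max_eq_left (integral_nonneg fun x => expE_nonneg _)]
  push_cast
  rfl

lemma Jf_cases {Q : Measure ℝ} [IsProbabilityMeasure Q] {φ : ℝ → EReal} (h : MemPhi φ) :
    Jf Q φ = ⊥ ∨ GoodI Q φ := by
  rcases good_or_bot (Q := Q) h with hb | hb
  · left; unfold Jf; rw [hb]; simp
  · right; exact hb

lemma Lfunc_eq {Q : Measure ℝ} (hi : Integrable (fun x : ℝ => x) Q)
    (hd : ¬ ∃ c : ℝ, Q = Measure.dirac c) :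
    Lfunc Q = sSup {r : EReal | ∃ φ, MemPhi φ ∧ r = Jf Q φ} := by
  unfold Lfunc
  rw [if_neg (not_not.2 hi), if_neg hd]
  rfl

lemma Jf_le_Lfunc {Q : Measure ℝ} (hi : Integrable (fun x : ℝ => x) Q)
    (hd : ¬ ∃ c : ℝ, Q = Measure.dirac c) {φ : ℝ → EReal} (h : MemPhi φ) :
    Jf Q φ ≤ Lfunc Q := by
  rw [Lfunc_eq hi hd]
  exact le_sSup ⟨φ, h, rfl⟩

lemma nondeg {α : Type*} [MeasurableSpace α] {ν : Measure α} [IsProbabilityMeasure ν] {g : α → ℝ}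
    (hi : Integrable g ν) {m : ℝ} (hm : ∫ x, g x ∂ν = m)
    (hne : ¬ ∀ᵐ x ∂ν, g x = m) :
    ∃ b, m < b ∧ 0 < ν {x | g x ≤ m} ∧ 0 < ν {x | b ≤ g x} := by
  have h1 : 0 < ν {x | g x ≤ m} := by
    by_contra hc
    have hc : ν {x | g x ≤ m} = 0 := by simpa using hc
    have hae : ∀ᵐ x ∂ν, m < g x := by
      rw [ae_iff]; simpa using hc
    have := (integral_eq_zero_iff_of_nonneg_ae (f := fun x => g x - m) (μ := ν)
      (by filter_upwards [hae] with x hx; simpa using hx.le) (hi.sub (integrable_const m))).1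
      (by rw [integral_sub hi (integrable_const m), hm]; simp)
    refine hne ?_
    filter_upwards [this] with x hx
    simpa [sub_eq_zero] using hx
  have h2 : 0 < ν {x | m < g x} := by
    by_contra hc
    have hc : ν {x | m < g x} = 0 := by simpa using hc
    have hae : ∀ᵐ x ∂ν, g x ≤ m := by
      rw [ae_iff]; simpa using hc
    have := (integral_eq_zero_iff_of_nonneg_ae (f := fun x => m - g x) (μ := ν)
      (by filter_upwards [hae] with x hx; simpa using hx) ((integrable_const m).sub hi)).1
      (by rw [integral_sub (integrable_const m) hi, hm]; simp)
    refine hne ?_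
    filter_upwards [this] with x hx
    have : m - g x = 0 := hx
    linarith
  have h3 : {x | m < g x} = ⋃ n : ℕ, {x | m + 1 / ((n : ℝ) + 1) ≤ g x} := by
    ext x
    simp only [Set.mem_ofPred_eq, Set.mem_iUnion]
    constructor
    · intro hx
      obtain ⟨n, hn⟩ := exists_nat_one_div_lt (sub_pos.2 hx)
      exact ⟨n, by linarith⟩
    · rintro ⟨n, hn⟩
      have : (0 : ℝ) < 1 / ((n : ℝ) + 1) := by positivity
      linarith
  rw [h3] at h2
  obtain ⟨n, hn⟩ := exists_measure_pos_of_not_measure_iUnion_null h2.ne'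
  refine ⟨m + 1 / ((n : ℝ) + 1), ?_, h1, hn⟩
  have : (0 : ℝ) < 1 / ((n : ℝ) + 1) := by positivity
  linarith

lemma eq_dirac_of_ae {Q : Measure ℝ} [IsProbabilityMeasure Q] {c : ℝ} (h : ∀ᵐ x ∂Q, x = c) :
    Q = Measure.dirac c := by
  have h1 : Q.map (fun x => x) = Q.map (fun _ => c) := Measure.map_congr h
  rw [Measure.map_const] at h1
  simpa using h1

lemma Q_nondeg {Q : Measure ℝ} (hQ : MemQstar Q) :
    ∃ a b η : ℝ, a < b ∧ 0 < η ∧ η ≤ Q.real (Set.Iic a) ∧ η ≤ Q.real (Set.Ici b) := by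
  obtain ⟨hp, hi, hd⟩ := hQ
  obtain ⟨b, hb, h1, h2⟩ := nondeg hi rfl
    (fun h => hd ⟨_, eq_dirac_of_ae h⟩)
  refine ⟨_, b, min (Q.real (Set.Iic _)) (Q.real (Set.Ici b)), hb, ?_, min_le_left _ _,
    min_le_right _ _⟩
  refine lt_min ?_ ?_
  · exact ENNReal.toReal_pos h1.ne' (measure_ne_top _ _)
  · exact ENNReal.toReal_pos h2.ne' (measure_ne_top _ _)

lemma int_le {Q : Measure ℝ} [IsProbabilityMeasure Q] {φ : ℝ → EReal} (hg : GoodI Q φ)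
    {M u η : ℝ} (hM : ∀ x, φ x ≤ M) {A : Set ℝ} (hA : MeasurableSet A) (hη : η ≤ Q.real A)
    (hu : 0 ≤ u) (h : ∀ x ∈ A, φ x ≤ ((M - u : ℝ) : EReal)) :
    ∫ x, (φ x).toReal ∂Q ≤ M - η * u := by
  have h1 : ∫ x, (φ x).toReal ∂Q ≤ ∫ x, (M - A.indicator (fun _ => u) x) ∂Q := by
    refine integral_mono_ae hg.2 ((integrable_const M).sub ((integrable_const u).indicator hA)) ?_
    filter_upwards [hg.1] with x hx
    have e := EReal.coe_toReal hx.1 hx.2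
    have hMx := hM x
    by_cases hxA : x ∈ A
    · have := h x hxA
      rw [Set.indicator_of_mem hxA]
      rw [← e] at this
      exact_mod_cast this
    · rw [Set.indicator_of_notMem hxA, sub_zero]
      rw [← e] at hMx
      exact_mod_cast hMx
  rw [integral_sub (integrable_const M) ((integrable_const u).indicator hA),
    integral_indicator hA, setIntegral_const] at h1
  simp only [integral_const, smul_eq_mul, probReal_univ, one_mul] at h1
  nlinarith

lemma W_ge {φ : ℝ → EReal} (h : MemPhi φ) {x0 p M u d : ℝ} (hx0 : φ x0 = M)
    (hu : 1 ≤ u) (hp : ((M - u : ℝ) : EReal) ≤ φ p) (hd : d ≤ |p - x0|) :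
    Real.exp (M - 1) * (d / u) ≤ ∫ x, expE (φ x) := by
  have hu0 : 0 < u := by linarith
  have h1u : 1 / u ≤ 1 := (div_le_one hu0).2 hu
  have h2 := conc_of_memPhi h hp hx0.ge (t := 1 / u) (by positivity) h1u
  have e1 : 1 / u * (M - u) + (1 - 1 / u) * M = M - 1 := by field_simp; ring
  rw [e1] at h2
  set q := 1 / u * p + (1 - 1 / u) * x0 with hq
  have hM1 : ((M - 1 : ℝ) : EReal) ≤ φ x0 := by
    rw [hx0]; exact_mod_cast (by linarith : M - 1 ≤ M)
  have hqx : q - x0 = (p - x0) / u := by rw [hq]; field_simp; ring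
  have key : ∀ l r : ℝ, ((M - 1 : ℝ) : EReal) ≤ φ l → ((M - 1 : ℝ) : EReal) ≤ φ r → l ≤ r →
      Real.exp (M - 1) * (r - l) ≤ ∫ x, expE (φ x) := by
    intro l r hl hr hlr
    have iF := integrable_expE h
    have h1 : ∫ x in Set.Icc l r, Real.exp (M - 1) ≤ ∫ x in Set.Icc l r, expE (φ x) := by
      refine setIntegral_mono_on (by simp) iF.integrableOn measurableSet_Icc ?_
      intro x hx
      exact le_expE (h.1 x) (seg_ge h hl hr hx.1 hx.2)
    have h2 : ∫ x in Set.Icc l r, expE (φ x) ≤ ∫ x, expE (φ x) :=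
      setIntegral_le_integral iF (ae_of_all _ fun x => expE_nonneg _)
    refine le_trans (le_of_eq ?_) (h1.trans h2)
    rw [setIntegral_const, smul_eq_mul, Measure.real, Real.volume_Icc,
      ENNReal.toReal_ofReal (by linarith), mul_comm]
  rcases le_total x0 p with hx | hx
  · rw [abs_of_nonneg (by linarith)] at hd
    have h3 : d / u ≤ q - x0 := by rw [hqx]; gcongr
    have h4 : 0 ≤ q - x0 := by rw [hqx]; exact div_nonneg (by linarith) hu0.le
    exact le_trans (by gcongr) (key x0 q hM1 h2 (by linarith))
  · rw [abs_of_nonpos (by linarith)] at hd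
    have h3 : d / u ≤ x0 - q := by 
      have : x0 - q = -(p - x0) / u := by rw [neg_div, ← hqx]; ring
      rw [this]; gcongr
    have h4 : q - x0 ≤ 0 := by rw [hqx]; exact div_nonpos_of_nonpos_of_nonneg (by linarith) hu0.le
    exact le_trans (by gcongr) (key q x0 h2 hM1 (by linarith))

lemma Lfunc_ne_top {Q : Measure ℝ} (hQ : MemQstar Q) : Lfunc Q ≠ ⊤ := by
  obtain ⟨a, b, η, hab, hη, hA, hB⟩ := Q_nondeg hQ
  obtain ⟨hp, hi, hd⟩ := hQ
  set d := (b - a) / 2 with hdd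
  have hdpos : 0 < d := by rw [hdd]; linarith
  set κ := min η (d * Real.exp (-1)) with hκd
  have hκ : 0 < κ := lt_min hη (by positivity)
  have hκ1 : κ ≤ η := min_le_left _ _
  have hκ2 : κ ≤ d * Real.exp (-1) := min_le_right _ _
  suffices Lfunc Q ≤ ((2 / κ + 1 : ℝ) : EReal) by
    exact (lt_of_le_of_lt this (EReal.coe_lt_top _)).ne
  rw [Lfunc_eq hi hd]
  refine sSup_le ?_
  rintro _ ⟨φ, h, rfl⟩
  rcases Jf_cases (Q := Q) h with hbot | hg
  · rw [hbot]; exact bot_le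
  rw [Jf_good h hg]
  suffices ∫ x, (φ x).toReal ∂Q - ∫ x, expE (φ x) ≤ 2 / κ by exact_mod_cast (by linarith)
  have hne : ∃ x, φ x ≠ ⊥ := by
    obtain ⟨x, hx⟩ := hg.1.exists
    exact ⟨x, hx.2⟩
  obtain ⟨x0, M, hx0, hM⟩ := exists_max h hne
  have hW : 0 ≤ ∫ x, expE (φ x) := integral_nonneg fun x => expE_nonneg _
  have hM0 : ∫ x, (φ x).toReal ∂Q ≤ M := by
    have := int_le hg (u := 0) (η := 0) hM MeasurableSet.univ measureReal_nonneg le_rfl (by simpa using hM)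
    simpa using this
  have h2k : 0 < 2 / κ := by positivity
  by_cases hMs : M < 0
  · linarith
  push Not at hMs
  set u := Real.exp (M / 2) with hu
  have hu1 : 1 ≤ u := Real.one_le_exp (by linarith)
  have huM : u * u = Real.exp M := by rw [hu, ← Real.exp_add]; congr 1; ring
  have hfin : M - κ * u ≤ 2 / κ := by
    have h1 : 1 + M / 2 + (M / 2) ^ 2 / 2 ≤ u := Real.quadratic_le_exp_of_nonneg (by linarith)
    have h2 : κ * (M ^ 2 / 8) ≤ κ * u := by
      refine mul_le_mul_of_nonneg_left ?_ hκ.le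
      nlinarith
    have h3 : M - κ * (M ^ 2 / 8) ≤ 2 / κ := by
      rw [le_div_iff₀ hκ]
      nlinarith [sq_nonneg (κ * M - 4)]
    linarith
  have main : ∫ x, (φ x).toReal ∂Q - ∫ x, expE (φ x) ≤ M - κ * u := by
    by_cases c1 : ∀ x ∈ Set.Iic a, φ x ≤ ((M - u : ℝ) : EReal)
    · have := int_le hg hM measurableSet_Iic hA (by linarith) c1
      nlinarith
    by_cases c2 : ∀ x ∈ Set.Ici b, φ x ≤ ((M - u : ℝ) : EReal)
    · have := int_le hg hM measurableSet_Ici hB (by linarith) c2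
      nlinarith
    push Not at c1 c2
    obtain ⟨p, hpa, hp⟩ := c1
    obtain ⟨q, hqb, hq⟩ := c2
    have hpa : p ≤ a := hpa
    have hqb : b ≤ q := hqb
    have hWd : Real.exp (M - 1) * (d / u) ≤ ∫ x, expE (φ x) := by
      by_cases hx : x0 ≤ (a + b) / 2
      · refine W_ge h hx0 hu1 hq.le ?_
        rw [abs_of_nonneg (by linarith)]; linarith
      · push Not at hx
        refine W_ge h hx0 hu1 hp.le ?_
        rw [abs_of_nonpos (by linarith)]; linarith
    have e : Real.exp (M - 1) * (d / u) = d * Real.exp (-1) * u := by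
      rw [sub_eq_add_neg, Real.exp_add, ← huM]; field_simp
    rw [e] at hWd
    nlinarith
  linarith

lemma memPhi_negabs : MemPhi (fun x => ((-|x| : ℝ) : EReal)) := by
  refine ⟨fun x => EReal.coe_ne_top _, concave_of (fun x => EReal.coe_ne_top _) ?_, ?_, ?_⟩
  · intro x y c d t hx hy h0 h1
    have hx : -|x| = c := by exact_mod_cast hx
    have hy : -|y| = d := by exact_mod_cast hy
    have h3 : |t * x + (1 - t) * y| ≤ t * |x| + (1 - t) * |y| := by
      refine (abs_add_le _ _).trans ?_
      rw [abs_mul, abs_mul, abs_of_nonneg h0, abs_of_nonneg (sub_nonneg.2 h1)]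
    refine EReal.coe_le_coe_iff.2 ?_
    rw [← hx, ← hy]; linarith
  · exact (continuous_coe_real_ereal.comp continuous_abs.neg).upperSemicontinuous
  · refine EReal.tendsto_coe_atBot.comp ?_
    exact tendsto_neg_atTop_atBot.comp (tendsto_norm_cocompact_atTop (E := ℝ))

lemma Lfunc_ne_bot {Q : Measure ℝ} (hQ : MemQstar Q) : Lfunc Q ≠ ⊥ := by
  obtain ⟨hp, hi, hd⟩ := hQ
  have h1 := Jf_le_Lfunc hi hd memPhi_negabs
  rw [Jf_good memPhi_negabs ⟨ae_of_all _ fun x => ⟨EReal.coe_ne_top _, EReal.coe_ne_bot _⟩,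
    by simpa using hi.abs⟩] at h1
  exact (lt_of_lt_of_le (EReal.bot_lt_coe _) h1).ne'

end

noncomputable section

lemma scl_good {Q : Measure ℝ} [IsProbabilityMeasure Q] {φ : ℝ → EReal} {s : ℝ} (c : ℝ)
    (hg : GoodI Q (fun y => φ (s * y))) :
    GoodI Q (scl φ s c) ∧
      ∫ y, (scl φ s c y).toReal ∂Q = (∫ y, (φ (s * y)).toReal ∂Q) + c := by
  have e : (fun y => (scl φ s c y).toReal) =ᵐ[Q] fun y => (φ (s * y)).toReal + c := by
    filter_upwards [hg.1] with y hy
    unfold scl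
    rw [EReal.toReal_add hy.1 hy.2 (EReal.coe_ne_top _) (EReal.coe_ne_bot _), EReal.toReal_coe]
  refine ⟨⟨?_, ?_⟩, ?_⟩
  · filter_upwards [hg.1] with y hy
    have e := EReal.coe_toReal hy.1 hy.2
    unfold scl
    rw [← e, ← EReal.coe_add]
    exact ⟨EReal.coe_ne_top _, EReal.coe_ne_bot _⟩
  · exact (hg.2.add (integrable_const c)).congr e.symm
  · rw [integral_congr_ae e, integral_add hg.2 (integrable_const c)]; simp

lemma hsum_good {Q : Measure ℝ} {f g : ℝ → EReal} (hf : GoodI Q f) (hg : GoodI Q g) :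
    GoodI Q (hsum f g) ∧ ∫ y, (hsum f g y).toReal ∂Q =
      1 / 2 * ((∫ y, (f y).toReal ∂Q) + ∫ y, (g y).toReal ∂Q) := by
  have e0 : ∀ᵐ y ∂Q, hsum f g y = ((1 / 2 * ((f y).toReal + (g y).toReal) : ℝ) : EReal) := by
    filter_upwards [hf.1, hg.1] with y h1 h2
    unfold hsum
    rw [EReal.coe_mul, EReal.coe_add, EReal.coe_toReal h1.1 h1.2, EReal.coe_toReal h2.1 h2.2]
  have e : (fun y => (hsum f g y).toReal) =ᵐ[Q] fun y => 1 / 2 * ((f y).toReal + (g y).toReal) := by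
    filter_upwards [e0] with y hy
    rw [hy, EReal.toReal_coe]
  refine ⟨⟨?_, ?_⟩, ?_⟩
  · filter_upwards [e0] with y hy
    rw [hy]
    exact ⟨EReal.coe_ne_top _, EReal.coe_ne_bot _⟩
  · exact ((hf.2.add hg.2).const_mul _).congr e.symm
  · rw [integral_congr_ae e, integral_const_mul, integral_add hf.2 hg.2]

lemma scl_scl {φ : ℝ → EReal} {x x' : ℝ} (hx : 0 < x) (hx' : 0 < x') :
    scl (scl φ x (Real.log x)) (x' / x) (Real.log (x' / x)) = scl φ x' (Real.log x') := by
  ext y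
  unfold scl
  have e : x * (x' / x * y) = x' * y := by field_simp
  rw [e, add_assoc, ← EReal.coe_add, Real.log_div hx'.ne' hx.ne']
  congr 3; ring

/-- defect -/
def Dd (Q : Measure ℝ) (l : ℝ) (φ : ℝ → EReal) (x : ℝ) : ℝ :=
  l - ((∫ y, (φ (x * y)).toReal ∂Q) + Real.log x - (∫ z, expE (φ z)) + 1)

lemma int_le_L {Q : Measure ℝ} (hQ : MemQstar Q) {l : ℝ} (hl : Lfunc Q = l) {ψ : ℝ → EReal}
    (h : MemPhi ψ) (hg : GoodI Q ψ) :
    (∫ y, (ψ y).toReal ∂Q) - (∫ z, expE (ψ z)) + 1 ≤ l := by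
  have h1 := Jf_le_Lfunc hQ.2.1 hQ.2.2 h
  rw [Jf_good h hg, hl] at h1
  exact_mod_cast h1

lemma Dd_nonneg {Q : Measure ℝ} (hQ : MemQstar Q) {l : ℝ} (hl : Lfunc Q = l) {φ : ℝ → EReal}
    (h : MemPhi φ) {x : ℝ} (hx : 0 < x) (hg : GoodI Q (fun y => φ (x * y))) :
    0 ≤ Dd Q l φ x := by
  haveI := hQ.1
  obtain ⟨h1, h2⟩ := scl_good (Real.log x) hg
  have := int_le_L hQ hl (memPhi_scl h hx _) h1
  rw [h2, integral_scl h hx] at this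
  unfold Dd
  linarith

/-- the gap -/
def gap (s0 : ℝ) : ℝ := min (Real.log 2 - 1 / 2) (kap s0 ^ 2 / 8)

lemma gap_pos {s0 : ℝ} (hs0 : 1 < s0) : 0 < gap s0 := by
  have := Real.log_two_gt_d9
  have := kap_pos hs0
  exact lt_min (by linarith) (by positivity)

lemma two_point {Q : Measure ℝ} (hQ : MemQstar Q) {l : ℝ} (hl : Lfunc Q = l) {φ : ℝ → EReal}
    (h : MemPhi φ) {x x' s0 : ℝ} (hx : 0 < x) (hs0 : 1 < s0) (hxx : s0 * x ≤ x')
    (hg : GoodI Q (fun y => φ (x * y))) (hg' : GoodI Q (fun y => φ (x' * y))) :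
    gap s0 ≤ Dd Q l φ x + Dd Q l φ x' := by
  haveI := hQ.1
  have hx' : 0 < x' := by nlinarith
  have d0 := Dd_nonneg hQ hl h hx hg
  have d0' := Dd_nonneg hQ hl h hx' hg'
  obtain ⟨g1, e1⟩ := scl_good (Real.log x) hg
  obtain ⟨g2, e2⟩ := scl_good (Real.log x') hg'
  have m1 := memPhi_scl h hx (Real.log x)
  have m2 := memPhi_scl h hx' (Real.log x')
  set W := ∫ z, expE (φ z) with hW
  by_cases hc : W ≤ 1 / 2
  · obtain ⟨g3, e3⟩ := scl_good (Real.log x + Real.log 2) hg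
    have m3 := memPhi_scl h hx (Real.log x + Real.log 2)
    have h3 := int_le_L hQ hl m3 g3
    have e4 : ∫ z, expE (scl φ x (Real.log x + Real.log 2) z) = 2 * W := by
      rw [hW, ← integral_scl h hx, ← integral_const_mul]
      congr 1; ext z
      rw [expE_scl _ h.1, expE_scl _ h.1, Real.exp_add, Real.exp_log (by norm_num : (0 : ℝ) < 2)]
      ring
    rw [e3, e4] at h3
    have : gap s0 ≤ Real.log 2 - 1 / 2 := min_le_left _ _
    have : Real.log 2 - 1 / 2 ≤ Dd Q l φ x := by
      unfold Dd
      linarith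
    linarith
  · push Not at hc
    have hs : s0 ≤ x' / x := (le_div_iff₀ hx).2 hxx
    have eW := integral_scl h hx
    have hh := hell m1 hs0 hs (by rw [eW]; linarith)
    rw [scl_scl hx hx', eW] at hh
    obtain ⟨g3, e3⟩ := hsum_good g1 g2
    have h3 := int_le_L hQ hl (memPhi_hsum m1 m2) g3
    rw [e3, e1, e2] at h3
    have h4 : gap s0 ≤ kap s0 ^ 2 / 8 := min_le_right _ _
    have h5 : gap s0 ≤ 2 * (W * (kap s0 ^ 2 / 8)) := by
      have : 0 ≤ kap s0 ^ 2 / 8 := by positivity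
      nlinarith
    unfold Dd
    rw [← hW] at hh ⊢
    linarith

lemma strict {P Q : Measure ℝ} [IsProbabilityMeasure P] (hQ : MemQstar Q) {l : ℝ}
    (hl : Lfunc Q = l) {m : ℝ} (hpos : ∀ᵐ x ∂P, 0 < x) (hi : Integrable Real.log P)
    (hm : ∫ x, Real.log x ∂P = m) (hne : ¬ ∀ᵐ x ∂P, Real.log x = m) :
    ∃ c > 0, ∀ φ, MemPhi φ →
      Jf ((P.prod Q).map (fun z => z.1 * z.2)) φ ≤ ((l - m - c : ℝ) : EReal) := by
  haveI := hQ.1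
  obtain ⟨b, hb, hP1, hP2⟩ := nondeg hi hm hne
  set s0 := Real.exp (b - m) with hs0d
  have hs0 : 1 < s0 := Real.one_lt_exp_iff.2 (by linarith)
  have hgap := gap_pos hs0
  set A : Set ℝ := {x | Real.log x ≤ m} with hA
  set B : Set ℝ := {x | b ≤ Real.log x} with hB
  have mA : MeasurableSet A := measurableSet_le Real.measurable_log measurable_const
  have mB : MeasurableSet B := measurableSet_le measurable_const Real.measurable_log
  set η := min (P.real A) (P.real B) with hη
  have hη0 : 0 < η := lt_min (ENNReal.toReal_pos hP1.ne' (measure_ne_top _ _))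
    (ENNReal.toReal_pos hP2.ne' (measure_ne_top _ _))
  refine ⟨η * (gap s0 / 2), by positivity, fun φ h => ?_⟩
  have hmul : Measurable (fun z : ℝ × ℝ => z.1 * z.2) := measurable_fst.mul measurable_snd
  set ρ := (P.prod Q).map (fun z => z.1 * z.2) with hR
  haveI : IsProbabilityMeasure ρ := Measure.isProbabilityMeasure_map hmul.aemeasurable
  rcases Jf_cases (Q := ρ) h with hbot | hg
  · rw [hbot]; exact bot_le
  rw [Jf_good h hg]
  have hφm : Measurable (fun x => (φ x).toReal) := measurable_ereal_toReal.comp h.2.2.1.measurable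
  have hint : Integrable (fun z : ℝ × ℝ => (φ (z.1 * z.2)).toReal) (P.prod Q) :=
    (integrable_map_measure hφm.aestronglyMeasurable hmul.aemeasurable).1 hg.2
  have hae : ∀ᵐ x ∂P, ∀ᵐ y ∂Q, φ (x * y) ≠ ⊤ ∧ φ (x * y) ≠ ⊥ :=
    Measure.ae_ae_of_ae_prod (ae_of_ae_map hmul.aemeasurable hg.1)
  have hgood : ∀ᵐ x ∂P, 0 < x ∧ GoodI Q (fun y => φ (x * y)) := by
    filter_upwards [hpos, hae, hint.prod_right_ae] with x h1 h2 h3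
    exact ⟨h1, h2, h3⟩
  have hT : Integrable (fun x => ∫ y, (φ (x * y)).toReal ∂Q) P := hint.integral_prod_left
  have eT : ∫ x, (φ x).toReal ∂ρ = ∫ x, ∫ y, (φ (x * y)).toReal ∂Q ∂P := by
    rw [hR, integral_map hmul.aemeasurable hφm.aestronglyMeasurable, integral_prod _ hint]
  set W := ∫ z, expE (φ z) with hW
  have iD : Integrable (Dd Q l φ) P := by
    unfold Dd
    exact (integrable_const l).sub
      (((hT.add hi).sub (integrable_const W)).add (integrable_const 1))
  have eD : ∫ x, Dd Q l φ x ∂P = l - ((∫ x, (φ x).toReal ∂ρ) + m - W + 1) := by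
    unfold Dd
    have i1 : Integrable (fun x => (∫ y, (φ (x * y)).toReal ∂Q) + Real.log x) P := hT.add hi
    have i2 : Integrable (fun x => (∫ y, (φ (x * y)).toReal ∂Q) + Real.log x - W) P :=
      i1.sub (integrable_const W)
    have i3 : Integrable (fun x => (∫ y, (φ (x * y)).toReal ∂Q) + Real.log x - W + 1) P :=
      i2.add (integrable_const 1)
    rw [← hW, integral_sub (integrable_const l) i3, integral_add i2 (integrable_const 1),
      integral_sub i1 (integrable_const W), integral_add hT hi, ← eT, hm]
    simp
  have key : ∃ C : Set ℝ, MeasurableSet C ∧ η ≤ P.real C ∧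
      ∀ x, 0 < x → GoodI Q (fun y => φ (x * y)) → x ∈ C → gap s0 / 2 ≤ Dd Q l φ x := by
    by_cases hc : ∀ x, 0 < x → GoodI Q (fun y => φ (x * y)) → x ∈ A → gap s0 / 2 ≤ Dd Q l φ x
    · exact ⟨A, mA, min_le_left _ _, hc⟩
    · push Not at hc
      obtain ⟨x1, hx1, hg1, hA1, hD1⟩ := hc
      refine ⟨B, mB, min_le_right _ _, fun x hx hgx hxB => ?_⟩
      have hxx : s0 * x1 ≤ x := by
        have hA1 : Real.log x1 ≤ m := hA1
        have hxB : b ≤ Real.log x := hxB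
        rw [hs0d, ← Real.exp_log hx, ← Real.exp_log hx1, ← Real.exp_add]
        exact Real.exp_le_exp.2 (by linarith)
      have := two_point hQ hl h hx1 hs0 hxx hg1 hgx
      linarith
  obtain ⟨C, mC, hCη, hC⟩ := key
  have hlow : ∫ x, C.indicator (fun _ => gap s0 / 2) x ∂P ≤ ∫ x, Dd Q l φ x ∂P := by
    refine integral_mono_ae ((integrable_const _).indicator mC) iD ?_
    filter_upwards [hgood] with x hx
    by_cases hxC : x ∈ C
    · rw [Set.indicator_of_mem hxC]; exact hC x hx.1 hx.2 hxC
    · rw [Set.indicator_of_notMem hxC]; exact Dd_nonneg hQ hl h hx.1 hx.2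
  rw [integral_indicator mC, setIntegral_const, smul_eq_mul, eD] at hlow
  have : η * (gap s0 / 2) ≤ P.real C * (gap s0 / 2) := by gcongr
  exact EReal.coe_le_coe_iff.2 (by linarith)

lemma map_memQ {Q : Measure ℝ} (hQ : MemQstar Q) {c : ℝ} (hc : 0 < c) :
    MemQstar (Q.map (fun y => c * y)) := by
  haveI := hQ.1
  have hm : Measurable (fun y : ℝ => c * y) := measurable_const_mul c
  refine ⟨Measure.isProbabilityMeasure_map hm.aemeasurable, ?_, ?_⟩
  · rw [integrable_map_measure measurable_id'.aestronglyMeasurable hm.aemeasurable]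
    exact hQ.2.1.const_mul c
  · rintro ⟨d, hd⟩
    refine hQ.2.2 ⟨c⁻¹ * d, ?_⟩
    have h2 : (Q.map (fun y => c * y)).map (fun y => c⁻¹ * y) = Measure.dirac (c⁻¹ * d) := by
      rw [hd, Measure.map_dirac' (measurable_const_mul c⁻¹) d]
    rw [Measure.map_map (measurable_const_mul c⁻¹) hm] at h2
    rw [← h2]
    conv_lhs => rw [← Measure.map_id (μ := Q)]
    congr 1; ext y; exact (inv_mul_cancel_left₀ hc.ne' y).symm

lemma L_scale {Q : Measure ℝ} (hQ : MemQstar Q) {c : ℝ} (hc : 0 < c) :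
    Lfunc (Q.map (fun y => c * y)) ≤ Lfunc Q - ((Real.log c : ℝ) : EReal) := by
  have hR := map_memQ hQ hc
  haveI := hQ.1
  haveI := hR.1
  have hm : Measurable (fun y : ℝ => c * y) := measurable_const_mul c
  obtain ⟨l, hl⟩ : ∃ l : ℝ, Lfunc Q = l :=
    ⟨_, (EReal.coe_toReal (Lfunc_ne_top hQ) (Lfunc_ne_bot hQ)).symm⟩
  rw [hl, ← EReal.coe_sub, Lfunc_eq hR.2.1 hR.2.2]
  refine sSup_le ?_
  rintro _ ⟨φ, h, rfl⟩
  rcases Jf_cases (Q := Q.map (fun y => c * y)) h with hbot | hg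
  · rw [hbot]; exact bot_le
  rw [Jf_good h hg]
  have hφm : Measurable (fun x => (φ x).toReal) := measurable_ereal_toReal.comp h.2.2.1.measurable
  have hg' : GoodI Q (fun y => φ (c * y)) :=
    ⟨ae_of_ae_map hm.aemeasurable hg.1,
      (integrable_map_measure hφm.aestronglyMeasurable hm.aemeasurable).1 hg.2⟩
  have := Dd_nonneg hQ hl h hc hg'
  unfold Dd at this
  rw [integral_map hm.aemeasurable hφm.aestronglyMeasurable]
  exact EReal.coe_le_coe_iff.2 (by linarith)

lemma L_scale_eq {Q : Measure ℝ} (hQ : MemQstar Q) {c : ℝ} (hc : 0 < c) :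
    Lfunc (Q.map (fun y => c * y)) = Lfunc Q - ((Real.log c : ℝ) : EReal) := by
  have hR := map_memQ hQ hc
  refine le_antisymm (L_scale hQ hc) ?_
  have h1 := L_scale hR (inv_pos.2 hc)
  rw [Measure.map_map (measurable_const_mul c⁻¹) (measurable_const_mul c)] at h1
  have e : Q.map ((fun y => c⁻¹ * y) ∘ fun y => c * y) = Q := by
    conv_rhs => rw [← Measure.map_id (μ := Q)]
    congr 1; ext y; simp [hc.ne']
  rw [e, Real.log_inv] at h1
  have e1 := EReal.coe_toReal (Lfunc_ne_top hQ) (Lfunc_ne_bot hQ)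
  have e2 := EReal.coe_toReal (Lfunc_ne_top hR) (Lfunc_ne_bot hR)
  rw [← e1, ← e2, ← EReal.coe_sub, EReal.coe_le_coe_iff] at h1 ⊢
  linarith

lemma Lfunc_dirac (c : ℝ) : Lfunc (Measure.dirac c) = ⊤ := by
  unfold Lfunc
  rw [if_neg, if_pos ⟨c, rfl⟩]
  rw [not_not]
  exact integrable_dirac (by simp)

lemma measurable_elog : Measurable elog := by
  unfold elog
  exact Measurable.ite measurableSet_Iic measurable_const
    (measurable_coe_real_ereal.comp Real.measurable_log)

end

/-- **Theorem A.6, equality part.**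
In the setting of the Jensen-type inequality `L(Law(XY)) ≤ L(Law(Y)) − m`, equality
holds if and only if `X = e^m` almost surely (with `e^{−∞} = 0` when `m = −∞`). -/
theorem Lfunc_mul_eq_iff
    {Ω : Type*} [MeasurableSpace Ω] (μ : Measure Ω) [IsProbabilityMeasure μ]
    (X Y : Ω → ℝ) (hX : Measurable X) (hY : Measurable Y)
    (hind : IndepFun X Y μ)
    (hXpos : ∀ᵐ ω ∂μ, 0 ≤ X ω)
    (hQ : MemQstar (μ.map Y))
    (m : EReal) (hm : m ≠ ⊤)
    (hlog : integralEReal (μ.map X) (fun x => elog x) = m) :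
    Lfunc (μ.map (fun ω => X ω * Y ω)) = Lfunc (μ.map Y) - m ↔
      ∀ᵐ ω ∂μ, X ω = expE m := by
  have hmX : AEMeasurable X μ := hX.aemeasurable
  have hmY : AEMeasurable Y μ := hY.aemeasurable
  haveI hPp : IsProbabilityMeasure (μ.map X) := Measure.isProbabilityMeasure_map hmX
  haveI := hQ.1
  have hXYm : Measurable (fun ω => X ω * Y ω) := hX.mul hY
  haveI hRp : IsProbabilityMeasure (μ.map (fun ω => X ω * Y ω)) :=
    Measure.isProbabilityMeasure_map hXYm.aemeasurable
  have hmul : Measurable (fun z : ℝ × ℝ => z.1 * z.2) := measurable_fst.mul measurable_snd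
  have hRprod : μ.map (fun ω => X ω * Y ω) =
      ((μ.map X).prod (μ.map Y)).map (fun z => z.1 * z.2) := by
    rw [← (indepFun_iff_map_prod_eq_prod_map_map hmX hmY).1 hind,
      Measure.map_map hmul (hX.prodMk hY)]
    rfl
  have hconst : ∀ c : ℝ, (∀ᵐ ω ∂μ, X ω = c) →
      μ.map (fun ω => X ω * Y ω) = (μ.map Y).map (fun y => c * y) := by
    intro c hc
    rw [Measure.map_map (measurable_const_mul c) hY]
    refine Measure.map_congr ?_
    filter_upwards [hc] with ω hω
    simp [hω]
  induction m with
  | top => exact absurd rfl hm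
  | bot =>
    have hLQ : Lfunc (μ.map Y) - ⊥ = ⊤ := by
      rw [← EReal.coe_toReal (Lfunc_ne_top hQ) (Lfunc_ne_bot hQ)]; simp
    rw [hLQ, expE_bot]
    constructor
    · intro hL
      by_cases hi : Integrable (fun x : ℝ => x) (μ.map (fun ω => X ω * Y ω))
      · by_cases hd : ∃ c : ℝ, μ.map (fun ω => X ω * Y ω) = Measure.dirac c
        · obtain ⟨c, hc⟩ := hd
          have h1 : ∀ᵐ z ∂(μ.map (fun ω => X ω * Y ω)), z = c := by
            rw [hc]; simp [ae_dirac_eq]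
          rw [hRprod] at h1
          have h2 := Measure.ae_ae_of_ae_prod (ae_of_ae_map hmul.aemeasurable h1)
          have h3 : ∀ᵐ x ∂(μ.map X), x = 0 := by
            filter_upwards [h2] with x hx
            by_contra hx0
            refine hQ.2.2 ⟨c / x, eq_dirac_of_ae ?_⟩
            filter_upwards [hx] with y hy
            rw [eq_div_iff hx0, mul_comm]; exact hy
          exact ae_of_ae_map hmX h3
        · exact absurd hL (Lfunc_ne_top ⟨hRp, hi, hd⟩)
      · unfold Lfunc at hL
        rw [if_pos hi] at hL
        exact absurd hL (by simp)
    · intro h0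
      rw [hconst 0 h0]
      have : (μ.map Y).map (fun y => (0 : ℝ) * y) = Measure.dirac 0 := by
        simp only [zero_mul]
        rw [Measure.map_const]; simp
      rw [this, Lfunc_dirac]
  | coe m =>
    rw [expE_coe]
    have hel : Measurable (fun x => elog x) := measurable_elog
    have hn : ∫⁻ x, erealPosPart (-(elog x)) ∂(μ.map X) ≠ ⊤ := by
      intro hn
      unfold integralEReal at hlog
      rw [hn, EReal.coe_ennreal_top, EReal.sub_top] at hlog
      exact EReal.coe_ne_bot _ hlog.symm
    have hp : ∫⁻ x, erealPosPart (elog x) ∂(μ.map X) ≠ ⊤ := by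
      intro hp
      unfold integralEReal at hlog
      rw [hp, EReal.coe_ennreal_top, ← EReal.coe_ennreal_toReal hn, EReal.top_sub_coe] at hlog
      exact EReal.coe_ne_top _ hlog.symm
    have hg := good_of_ne_top hel hp hn
    rw [integralEReal_of_good hg] at hlog
    have hpos : ∀ᵐ x ∂(μ.map X), 0 < x := by
      filter_upwards [hg.1] with x hx
      by_contra hc
      exact hx.2 (by unfold elog; rw [if_pos (not_lt.1 hc)])
    have ee : (fun x => (elog x).toReal) =ᵐ[μ.map X] Real.log := by
      filter_upwards [hpos] with x hx
      unfold elog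
      rw [if_neg (not_le.2 hx), EReal.toReal_coe]
    have hi : Integrable Real.log (μ.map X) := hg.2.congr ee
    have hm' : ∫ x, Real.log x ∂(μ.map X) = m := by
      rw [← integral_congr_ae ee]; exact_mod_cast hlog
    have hl := EReal.coe_toReal (Lfunc_ne_top hQ) (Lfunc_ne_bot hQ)
    constructor
    · intro hL
      by_contra hne
      have hne' : ¬ ∀ᵐ x ∂(μ.map X), Real.log x = m := by
        intro hc
        refine hne (ae_of_ae_map (p := fun x => x = Real.exp m) hmX ?_)
        filter_upwards [hc, hpos] with x h1 h2
        rw [← h1, Real.exp_log h2]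
      obtain ⟨c, hc, hJ⟩ := strict hQ hl.symm hpos hi hm' hne'
      rw [← hRprod] at hJ
      rw [← hl, ← EReal.coe_sub] at hL
      by_cases hiR : Integrable (fun x : ℝ => x) (μ.map (fun ω => X ω * Y ω))
      · by_cases hd : ∃ c : ℝ, μ.map (fun ω => X ω * Y ω) = Measure.dirac c
        · obtain ⟨c, hc⟩ := hd
          rw [hc, Lfunc_dirac] at hL
          exact EReal.coe_ne_top _ hL.symm
        · rw [Lfunc_eq hiR hd] at hL
          have : sSup {r : EReal | ∃ φ, MemPhi φ ∧ r = Jf (μ.map (fun ω => X ω * Y ω)) φ} ≤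
              (((Lfunc (μ.map Y)).toReal - m - c : ℝ) : EReal) := by
            refine sSup_le ?_
            rintro _ ⟨φ, h, rfl⟩
            exact hJ φ h
          rw [hL, EReal.coe_le_coe_iff] at this
          linarith
      · unfold Lfunc at hL
        rw [if_pos hiR] at hL
        exact EReal.coe_ne_bot _ hL.symm
    · intro h0
      rw [hconst _ h0, L_scale_eq hQ (Real.exp_pos m), Real.log_exp]
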